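/- arXiv:1708.04632 — 2 statements merged into one kernel-verified Lean document; each statement's English description precedes it below -/
import Mathlib

section
/- Let G be a finite simple graph with μ_α(G) ≤ 1. Then every vertex of G is adjacent to at most two vertices of degree 1. -/
/-- `s` is an independent set in `G`: no two vertices of `s` are adjacent. -/
def IndepSet {V : Type*} (G : SimpleGraph V) (s : Set V) : Prop :=
  ∀ ⦃a⦄, a ∈ s → ∀ ⦃b⦄, b ∈ s → ¬ G.Adj a b

/-- `s` is a maximal independent set in `G`. -/
def MaxIndepSet {V : Type*} (G : SimpleGraph V) (s : Set V) : Prop :=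
  IndepSet G s ∧ ∀ t : Set V, IndepSet G t → s ⊆ t → s = t

/-- `α(G)`: the maximum size of an independent set of `G`. -/
noncomputable def alphaNum {V : Type*} (G : SimpleGraph V) : ℕ :=
  sSup {n | ∃ s : Set V, IndepSet G s ∧ s.ncard = n}

/-- `i(G)`: the minimum size of a maximal independent set of `G`. -/
noncomputable def iNum {V : Type*} (G : SimpleGraph V) : ℕ :=
  sInf {n | ∃ s : Set V, MaxIndepSet G s ∧ s.ncard = n}

/-- The independence gap `μ_α(G) = α(G) - i(G)`. -/
noncomputable def indepGap {V : Type*} (G : SimpleGraph V) : ℕ :=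
  alphaNum G - iNum G

/-- `G` is well-covered: all maximal independent sets have the same size. -/
def WellCovered {V : Type*} (G : SimpleGraph V) : Prop :=
  alphaNum G = iNum G

/-- `G` is almost well-covered: its independence gap equals 1. -/
def AlmostWellCovered {V : Type*} (G : SimpleGraph V) : Prop :=
  indepGap G = 1

/-- The (open) neighborhood `N(I)` of a set of vertices `I`. -/
def nbhd {V : Type*} (G : SimpleGraph V) (I : Set V) : Set V :=
  {v | ∃ u ∈ I, G.Adj u v}

/-- `U(G)`: the set of vertices whose connected component induces a complete graph. -/
def completeU {V : Type*} (G : SimpleGraph V) : Set V :=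
  {u | G.IsClique (G.connectedComponentMk u).supp}

/-- A leaf: a vertex of the graph `G - U(G)` having degree 1 there. -/
def IsLeaf {V : Type*} (G : SimpleGraph V) (v : V) : Prop :=
  v ∉ completeU G ∧ {u | u ∉ completeU G ∧ G.Adj v u}.ncard = 1

/-- An internal vertex: a vertex of `G - U(G)` that is not a leaf. -/
def IsInternal {V : Type*} (G : SimpleGraph V) (v : V) : Prop :=
  v ∉ completeU G ∧ ¬ IsLeaf G v

/-- A vertex has type `k` if it is an internal vertex adjacent to exactly `k` leaves;
in addition every vertex of `U(G)` has type `0`. -/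
def HasType {V : Type*} (G : SimpleGraph V) (v : V) (k : ℕ) : Prop :=
  (IsInternal G v ∧ {u | IsLeaf G u ∧ G.Adj v u}.ncard = k) ∨ (v ∈ completeU G ∧ k = 0)

/-- The set of vertices of type `k`; `G_k` is the subgraph induced by this set. -/
def typeSet {V : Type*} (G : SimpleGraph V) (k : ℕ) : Set V :=
  {v | HasType G v k}

/-- The maximum number of vertices in a connected component of `G`. -/
noncomputable def maxCompCard {V : Type*} (G : SimpleGraph V) : ℕ :=
  sSup {n | ∃ c : G.ConnectedComponent, c.supp.ncard = n}

/-- `G` has no cycle of length `n`. -/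
def NoCycleOfLength {V : Type*} (G : SimpleGraph V) (n : ℕ) : Prop :=
  ∀ (v : V) (w : G.Walk v v), w.IsCycle → w.length ≠ n

/-- `G` has girth at least 6: no cycle of length 3, 4, or 5. -/
def GirthAtLeastSix {V : Type*} (G : SimpleGraph V) : Prop :=
  NoCycleOfLength G 3 ∧ NoCycleOfLength G 4 ∧ NoCycleOfLength G 5

/-- A pendant edge: an edge incident with a vertex of degree 1. -/
def pendantEdges {V : Type*} (G : SimpleGraph V) : Set (Sym2 V) :=
  {e | e ∈ G.edgeSet ∧ ∃ v ∈ e, (G.neighborSet v).ncard = 1}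

/-- The pendant edges of `G` are pairwise disjoint and cover every vertex of `G`. -/
def PendantPerfectMatching {V : Type*} (G : SimpleGraph V) : Prop :=
  (∀ e ∈ pendantEdges G, ∀ f ∈ pendantEdges G, e ≠ f → ∀ v : V, v ∈ e → v ∉ f) ∧
  (∀ v : V, ∃ e ∈ pendantEdges G, v ∈ e)

theorem IndepSet.exists_maxIndepSet_superset {V : Type*} [Finite V] {G : SimpleGraph V}
    {s : Set V} (hs : IndepSet G s) : ∃ t, s ⊆ t ∧ MaxIndepSet G t := by
  obtain ⟨t, hst, ht⟩ := (Set.toFinite {t : Set V | IndepSet G t}).exists_le_maximal hs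
  exact ⟨t, hst, ht.prop, fun u hu htu => ht.eq_of_le hu htu⟩

theorem IndepSet.ncard_le_alphaNum {V : Type*} [Finite V] {G : SimpleGraph V}
    {s : Set V} (hs : IndepSet G s) : s.ncard ≤ alphaNum G := by
  refine le_csSup ⟨Nat.card V, ?_⟩ ⟨s, hs, rfl⟩
  rintro n ⟨t, -, rfl⟩
  exact Set.ncard_le_card t

theorem MaxIndepSet.iNum_le_ncard {V : Type*} {G : SimpleGraph V}
    {s : Set V} (hs : MaxIndepSet G s) : iNum G ≤ s.ncard :=
  Nat.sInf_le ⟨s, hs, rfl⟩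

theorem eq_of_adj_of_ncard_neighborSet_eq_one {V : Type*} {G : SimpleGraph V} {u v w : V}
    (hu : (G.neighborSet u).ncard = 1) (hv : G.Adj u v) (hw : G.Adj u w) : v = w := by
  obtain ⟨x, hx⟩ := Set.ncard_eq_one.mp hu
  have hvx : v ∈ G.neighborSet u := hv
  have hwx : w ∈ G.neighborSet u := hw
  rw [hx] at hvx hwx
  exact hvx.trans hwx.symm

/-- Replacing a vertex of an independent set by its neighbors of degree 1 preserves
independence. -/
theorem IndepSet.diff_union_degree_one {V : Type*} {G : SimpleGraph V} {s : Set V}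
    (hs : IndepSet G s) (v : V) :
    IndepSet G ((s \ {v}) ∪ {u | G.Adj v u ∧ (G.neighborSet u).ncard = 1}) := by
  rintro a (⟨ha, hav⟩ | ⟨hva, ha⟩) b (⟨hb, hbv⟩ | ⟨hvb, hb⟩) hab
  · exact hs ha hb hab
  · exact hav (eq_of_adj_of_ncard_neighborSet_eq_one hb hab.symm hvb.symm)
  · exact hbv (eq_of_adj_of_ncard_neighborSet_eq_one ha hab hva.symm)
  · exact hvb.ne (eq_of_adj_of_ncard_neighborSet_eq_one ha hva.symm hab)

/-- If `μ_α(G) ≤ 1`, then every vertex of `G` is adjacent to at most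
two vertices of degree 1. -/
theorem adj_degree_one_le_two {V : Type*} [Fintype V] (G : SimpleGraph V)
    (h : indepGap G ≤ 1) (v : V) :
    {u | G.Adj v u ∧ (G.neighborSet u).ncard = 1}.ncard ≤ 2 := by
  have hv : IndepSet G {v} := by
    rintro a rfl b rfl
    exact G.irrefl
  obtain ⟨s, hvs, hs⟩ := hv.exists_maxIndepSet_superset
  have hvs : v ∈ s := hvs rfl
  have hdisj : Disjoint (s \ {v}) {u | G.Adj v u ∧ (G.neighborSet u).ncard = 1} :=
    Set.disjoint_left.mpr fun u hu hvu => hs.1 hvs hu.1 hvu.1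
  have halpha := (hs.1.diff_union_degree_one v).ncard_le_alphaNum
  rw [Set.ncard_union_eq hdisj] at halpha
  have hcard := Set.ncard_sdiff_singleton_add_one hvs
  have hi := hs.iNum_le_ncard
  unfold indepGap at h
  omega
end

section
/- Let G be a finite simple graph, let S be a nonempty subset of V(G), let H = G[S] be the subgraph of G induced on S, and let n_0 be the maximum number of vertices in a connected component of H. Then for every independent set I of G with I ⊆ V(G) ∖ S and every natural number k with k ≤ α(H) − i(H − N(I)), there exists an independent set I₁ ⊆ I of size |I₁| ≤ k·n_0 such that k ≤ α(H) − i(H − N(I₁)). Here N(I) denotes the neighborhood of I in G, and H − N(I) is the subgraph of G induced on S ∖ N(I). -/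
/-- A finite sum of integers that is at least `k` has a subsum of at most `k` terms that is at
least `k`. -/
theorem Finset.exists_subset_card_le_le_sum {ι : Type*} (f : ι → ℤ) (k : ℕ) (s : Finset ι)
    (hs : (k : ℤ) ≤ ∑ c ∈ s, f c) : ∃ t ⊆ s, t.card ≤ k ∧ (k : ℤ) ≤ ∑ c ∈ t, f c := by
  classical
  induction s using Finset.strongInduction with
  | H s ih =>
    by_cases hpos : ∃ c ∈ s, f c ≤ 0
    · obtain ⟨c, hc, hfc⟩ := hpos
      have hsum := Finset.add_sum_erase s f hc
      obtain ⟨t, ht, hcard, hle⟩ := ih _ (Finset.erase_ssubset hc) (by linarith)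
      exact ⟨t, ht.trans (Finset.erase_subset _ _), hcard, hle⟩
    · push Not at hpos
      rcases le_total s.card k with hcard | hcard
      · exact ⟨s, subset_rfl, hcard, hs⟩
      · obtain ⟨t, ht, rfl⟩ := Finset.exists_subset_card_eq hcard
        refine ⟨t, ht, le_rfl, ?_⟩
        simpa using Finset.card_nsmul_le_sum t f 1 fun c hc => hpos c (ht hc)

section InducedSubgraphs

variable {V : Type*} {G : SimpleGraph V}

theorem IndepSet.mono {s t : Set V} (ht : IndepSet G t) (hst : s ⊆ t) : IndepSet G s :=
  fun _ ha _ hb => ht (hst ha) (hst hb)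

theorem IndepSet.image_val {W : Set V} {s : Set W} (hs : IndepSet (G.induce W) s) :
    IndepSet G (Subtype.val '' s) := by
  rintro _ ⟨a, ha, rfl⟩ _ ⟨b, hb, rfl⟩
  exact hs ha hb

theorem IndepSet.preimage_val {W T : Set V} (hT : IndepSet G T) :
    IndepSet (G.induce W) (Subtype.val ⁻¹' T) :=
  fun _ ha _ hb => hT ha hb

theorem Set.ncard_preimage_val {W T : Set V} (hT : T ⊆ W) :
    (Subtype.val ⁻¹' T : Set W).ncard = T.ncard := by
  rw [← Set.ncard_image_of_injective _ Subtype.val_injective, Subtype.image_preimage_coe,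
    Set.inter_eq_right.mpr hT]

/-- A maximal independent set dominates the graph. -/
theorem MaxIndepSet.exists_adj {s : Set V} (hs : MaxIndepSet G s) {v : V} (hv : v ∉ s) :
    ∃ u ∈ s, G.Adj u v := by
  by_contra! hno
  refine hv ?_
  rw [hs.2 (insert v s) ?_ (Set.subset_insert _ _)]
  · exact Set.mem_insert _ _
  · rintro a (rfl | ha) b (rfl | hb)
    · exact G.irrefl
    · exact fun h => hno b hb h.symm
    · exact hno a ha
    · exact hs.1 ha hb

variable [Finite V]

theorem IndepSet.exists_maxIndepSet {s : Set V} (hs : IndepSet G s) :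
    ∃ t, s ⊆ t ∧ MaxIndepSet G t := by
  obtain ⟨t, hst, ht⟩ := Set.Finite.exists_le_maximal (Set.toFinite {t | IndepSet G t}) hs
  exact ⟨t, hst, ht.prop, fun r hr htr => htr.antisymm (ht.le_of_ge hr htr)⟩

theorem bddAbove_ncard_indepSet (G : SimpleGraph V) :
    BddAbove {n | ∃ s : Set V, IndepSet G s ∧ s.ncard = n} :=
  ⟨Nat.card V, by rintro _ ⟨s, -, rfl⟩; exact Set.ncard_le_card s⟩

theorem IndepSet.ncard_le_alphaNum_induce {S T : Set V} (hT : IndepSet G T) (hTS : T ⊆ S) :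
    T.ncard ≤ alphaNum (G.induce S) :=
  le_csSup (bddAbove_ncard_indepSet _) ⟨_, hT.preimage_val, Set.ncard_preimage_val hTS⟩

theorem exists_indepSet_ncard_eq_alphaNum_induce (G : SimpleGraph V) (S : Set V) :
    ∃ T ⊆ S, IndepSet G T ∧ T.ncard = alphaNum (G.induce S) := by
  obtain ⟨s, hs, hcard⟩ := Nat.sSup_mem (s := {n | ∃ s : Set S, IndepSet (G.induce S) s ∧
    s.ncard = n}) ⟨0, ∅, by simp [IndepSet], by simp⟩ (bddAbove_ncard_indepSet _)
  exact ⟨_, Subtype.coe_image_subset S s, hs.image_val,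
    (Set.ncard_image_of_injective _ Subtype.val_injective).trans hcard⟩

theorem exists_dominating_ncard_eq_iNum_induce (G : SimpleGraph V) (W : Set V) :
    ∃ T ⊆ W, IndepSet G T ∧ (∀ v ∈ W, v ∉ T → ∃ u ∈ T, G.Adj u v) ∧
      T.ncard = iNum (G.induce W) := by
  obtain ⟨r, -, hr⟩ := IndepSet.exists_maxIndepSet (G := G.induce W) (s := ∅) (by simp [IndepSet])
  obtain ⟨s, hs, hcard⟩ := Nat.sInf_mem (s := {n | ∃ s : Set W, MaxIndepSet (G.induce W) s ∧
    s.ncard = n}) ⟨_, r, hr, rfl⟩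
  refine ⟨_, Subtype.coe_image_subset W s, hs.1.image_val, fun v hv hvs => ?_,
    (Set.ncard_image_of_injective _ Subtype.val_injective).trans hcard⟩
  obtain ⟨u, hu, huv⟩ := hs.exists_adj (v := ⟨v, hv⟩) fun h => hvs ⟨_, h, rfl⟩
  exact ⟨u, ⟨u, hu, rfl⟩, huv⟩

/-- An independent subset of `W` extends to a maximal one, whose size bounds `i(G[W])`. -/
theorem IndepSet.exists_superset_iNum_induce_le {T W : Set V} (hT : IndepSet G T) (hTW : T ⊆ W) :
    ∃ M ⊆ W, T ⊆ M ∧ IndepSet G M ∧ iNum (G.induce W) ≤ M.ncard := by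
  obtain ⟨s, hTs, hs⟩ := (hT.preimage_val (W := W)).exists_maxIndepSet
  refine ⟨_, Subtype.coe_image_subset W s, fun v hv => ⟨⟨v, hTW hv⟩, hTs hv, rfl⟩,
    hs.1.image_val, Nat.sInf_le ⟨s, hs, ?_⟩⟩
  exact (Set.ncard_image_of_injective _ Subtype.val_injective).symm

theorem SimpleGraph.ConnectedComponent.ncard_supp_le_maxCompCard (c : G.ConnectedComponent) :
    c.supp.ncard ≤ maxCompCard G :=
  le_csSup ⟨Nat.card V, by rintro _ ⟨c, rfl⟩; exact Set.ncard_le_card _⟩ ⟨c, rfl⟩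

/-- If `S ∩ U` is a union of components of `G[S]` and `I₁ ⊆ I` dominates `S ∩ U ∩ N(I)`, then a gap
witnessed on `U` by independent sets `A` of `G[S]` and `B` of `G[S] - N(I)`, with `B` maximal, is a
lower bound for `α(G[S]) - i(G[S] - N(I₁))`. -/
theorem iNum_induce_add_le_alphaNum_induce {S U A B I I₁ : Set V}
    (hUcl : ∀ u ∈ S, ∀ v ∈ S, G.Adj u v → (u ∈ U ↔ v ∈ U))
    (hAS : A ⊆ S) (hA : IndepSet G A)
    (hBS : B ⊆ S \ nbhd G I) (hB : IndepSet G B)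
    (hBdom : ∀ v ∈ S \ nbhd G I, v ∉ B → ∃ u ∈ B, G.Adj u v)
    (hI₁ : I₁ ⊆ I) (hdom : ∀ v ∈ S ∩ U, v ∈ nbhd G I → v ∈ nbhd G I₁)
    {k : ℕ} (hk : k + (B ∩ U).ncard ≤ (A ∩ U).ncard) :
    k + iNum (G.induce (S \ nbhd G I₁)) ≤ alphaNum (G.induce S) := by
  have hN : nbhd G I₁ ⊆ nbhd G I := fun v ⟨u, hu, huv⟩ => ⟨u, hI₁ hu, huv⟩
  obtain ⟨M, hMS, hBM, hM, hMcard⟩ :=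
    (hB.mono (Set.inter_subset_left (t := U))).exists_superset_iNum_induce_le
      (W := S \ nbhd G I₁) fun v hv => ⟨(hBS hv.1).1, fun h => (hBS hv.1).2 (hN h)⟩
  have hMU : M ∩ U ⊆ B ∩ U := by
    rintro v ⟨hvM, hvU⟩
    refine ⟨?_, hvU⟩
    by_contra hvB
    have hvS := (hMS hvM).1
    obtain ⟨u, hu, huv⟩ := hBdom v ⟨hvS, fun h => (hMS hvM).2 (hdom v ⟨hvS, hvU⟩ h)⟩ hvB
    exact hM (hBM ⟨hu, (hUcl u (hBS hu).1 v hvS huv).2 hvU⟩) hvM huv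
  have hindep : IndepSet G (A ∩ U ∪ M \ U) := by
    rintro a (⟨ha, haU⟩ | ⟨ha, haU⟩) b (⟨hb, hbU⟩ | ⟨hb, hbU⟩) hab
    · exact hA ha hb hab
    · exact hbU ((hUcl a (hAS ha) b (hMS hb).1 hab).1 haU)
    · exact haU ((hUcl a (hMS ha).1 b (hAS hb) hab).2 hbU)
    · exact hM ha hb hab
  have hle := hindep.ncard_le_alphaNum_induce (S := S) (by
    rintro v (⟨hv, -⟩ | ⟨hv, -⟩)
    · exact hAS hv
    · exact (hMS hv).1)
  rw [Set.ncard_union_eq (Set.disjoint_left.2 fun v hv hv' => hv'.2 hv.2)] at hle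
  have hMsplit := Set.ncard_inter_add_ncard_sdiff_eq_ncard M U
  have hMB := Set.ncard_le_ncard hMU
  omega

/-- Every subset `X` of the neighborhood of `I` is dominated by at most `|X|` vertices of `I`. -/
theorem exists_subset_ncard_le_subset_nbhd {I X : Set V} (hX : X ⊆ nbhd G I) :
    ∃ I₁ ⊆ I, I₁.ncard ≤ X.ncard ∧ X ⊆ nbhd G I₁ := by
  choose! g hgI hgadj using fun v (hv : v ∈ X) => hX hv
  refine ⟨g '' X, ?_, Set.ncard_image_le (Set.toFinite X),
    fun v hv => ⟨g v, ⟨v, hv, rfl⟩, hgadj v hv⟩⟩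
  rintro _ ⟨v, hv, rfl⟩
  exact hgI v hv

end InducedSubgraphs

theorem Set.ncard_inter_preimage_eq_sum {V ι : Type*} [Finite V] (A : Set V) (f : V → ι)
    (P : Finset ι) : (A ∩ f ⁻¹' P).ncard = ∑ c ∈ P, (A ∩ f ⁻¹' {c}).ncard := by
  classical
  have := Fintype.ofFinite V
  rw [Set.ncard_eq_toFinset_card', Finset.card_eq_sum_card_fiberwise (f := f) (t := P)
    fun v hv => by simpa using (Set.mem_toFinset.1 hv).2]
  refine Finset.sum_congr rfl fun c hc => ?_
  rw [Set.ncard_eq_toFinset_card']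
  congr 1
  ext v
  simp only [Finset.mem_filter, Set.mem_toFinset, Set.mem_inter_iff, Set.mem_preimage,
    Set.mem_singleton_iff, Finset.mem_coe]
  exact ⟨fun h => ⟨h.1.1, h.2⟩, fun h => ⟨⟨h.1, h.2 ▸ hc⟩, h.2⟩⟩

/-- Domination lemma: if `I` is an independent set disjoint from `S` and
`k ≤ α(G[S]) − i(G[S] − N(I))`, then some `I₁ ⊆ I` with `|I₁| ≤ k·n₀` already satisfies
`k ≤ α(G[S]) − i(G[S] − N(I₁))`, where `n₀` is the maximum size of a component of `G[S]`. -/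
theorem exists_small_dominating_subset {V : Type*} [Fintype V] (G : SimpleGraph V)
    (S : Set V) (hS : S.Nonempty) (n0 : ℕ) (hn0 : n0 = maxCompCard (G.induce S))
    (I : Set V) (hI : IndepSet G I) (hIS : I ⊆ Sᶜ) (k : ℕ)
    (hk : k ≤ alphaNum (G.induce S) - iNum (G.induce (S \ nbhd G I))) :
    ∃ I₁ ⊆ I, IndepSet G I₁ ∧ I₁.ncard ≤ k * n0 ∧
      k ≤ alphaNum (G.induce S) - iNum (G.induce (S \ nbhd G I₁)) := by
  classical
  rcases Nat.eq_zero_or_pos k with rfl | hkpos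
  · exact ⟨∅, Set.empty_subset _, by simp [IndepSet], by simp, Nat.zero_le _⟩
  obtain ⟨A, hAS, hA, hAcard⟩ := exists_indepSet_ncard_eq_alphaNum_induce G S
  obtain ⟨B, hBS, hB, hBdom, hBcard⟩ := exists_dominating_ncard_eq_iNum_induce G (S \ nbhd G I)
  obtain ⟨s₀, hs₀⟩ := hS
  -- the component of a vertex of `S`, with an arbitrary value outside `S`
  let comp : V → (G.induce S).ConnectedComponent := fun v =>
    (G.induce S).connectedComponentMk (if h : v ∈ S then ⟨v, h⟩ else ⟨s₀, hs₀⟩)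
  have hcomp : ∀ v (h : v ∈ S), comp v = (G.induce S).connectedComponentMk ⟨v, h⟩ :=
    fun v h => by simp only [comp, dif_pos h]
  have hfiber : ∀ c, (S ∩ comp ⁻¹' {c}).ncard ≤ n0 := fun c => by
    have hsupp : S ∩ comp ⁻¹' {c} = Subtype.val '' c.supp := by
      ext v
      constructor
      · rintro ⟨hv, hvc⟩
        exact ⟨⟨v, hv⟩, (hcomp v hv).symm.trans hvc, rfl⟩
      · rintro ⟨⟨v, hv⟩, hvc, rfl⟩
        exact ⟨hv, (hcomp v hv).trans hvc⟩
    rw [hsupp, Set.ncard_image_of_injective _ Subtype.val_injective, hn0]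
    exact c.ncard_supp_le_maxCompCard
  have hsplit : ∀ T : Set V, T.ncard = ∑ c, (T ∩ comp ⁻¹' {c}).ncard := fun T => by
    rw [← Set.ncard_inter_preimage_eq_sum]
    simp
  obtain ⟨P, -, hPcard, hP⟩ := Finset.exists_subset_card_le_le_sum
    (fun c => ((A ∩ comp ⁻¹' {c}).ncard : ℤ) - (B ∩ comp ⁻¹' {c}).ncard) k Finset.univ (by
      rw [Finset.sum_sub_distrib, ← Nat.cast_sum, ← Nat.cast_sum, ← hsplit, ← hsplit]
      omega)
  rw [Finset.sum_sub_distrib, ← Nat.cast_sum, ← Nat.cast_sum,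
    ← Set.ncard_inter_preimage_eq_sum, ← Set.ncard_inter_preimage_eq_sum] at hP
  obtain ⟨I₁, hI₁, hI₁card, hdom⟩ := exists_subset_ncard_le_subset_nbhd (G := G) (I := I)
    (X := S ∩ comp ⁻¹' P ∩ nbhd G I) Set.inter_subset_right
  refine ⟨I₁, hI₁, hI.mono hI₁, ?_, ?_⟩
  · calc I₁.ncard ≤ (S ∩ comp ⁻¹' P).ncard :=
          hI₁card.trans (Set.ncard_le_ncard Set.inter_subset_left)
      _ = ∑ c ∈ P, (S ∩ comp ⁻¹' {c}).ncard := Set.ncard_inter_preimage_eq_sum _ _ _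
      _ ≤ P.card * n0 := Finset.sum_le_card_nsmul _ _ _ fun c _ => hfiber c
      _ ≤ k * n0 := Nat.mul_le_mul_right _ hPcard
  · have hclosed : ∀ u ∈ S, ∀ v ∈ S, G.Adj u v → (u ∈ comp ⁻¹' (P : Set _) ↔ v ∈ comp ⁻¹' P) := by
      intro u hu v hv huv
      have hadj : (G.induce S).Adj ⟨u, hu⟩ ⟨v, hv⟩ := huv
      rw [Set.mem_preimage, Set.mem_preimage, hcomp u hu, hcomp v hv,
        SimpleGraph.ConnectedComponent.sound hadj.reachable]
    have hgap := iNum_induce_add_le_alphaNum_induce hclosed hAS hA hBS hB hBdom hI₁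
      (fun v hv hvI => hdom ⟨hv, hvI⟩) (k := k) (by omega)
    omega
end
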